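/- arXiv:2407.05369 — 5 statements merged into one kernel-verified Lean document; each statement's English description precedes it below -/
import Mathlib

section
/- Let n ≥ 1 be a natural number. For any two generalized Fibonacci sequences G and H (i.e., any integer-valued sequences satisfying the Fibonacci recurrence), one has (∑_{k=0}^{2n} G_{2k(n+1)}) · (∑_{k=0}^{2n} H_{2n(k+1)}) = (∑_{k=0}^{2n} H_{2k(n+1)}) · (∑_{k=0}^{2n} G_{2n(k+1)}). In other words, the ratio of the sum of entries along the main diagonal to the sum of entries along the sub-diagonal of the (2n+1)×(2n+1) grid filled row-by-row with a generalized Fibonacci sequence depends only on n, not on the sequence. -/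
theorem gf_pair (e : ℕ) :
    (∃ L : ℤ, ∀ G : ℕ → ℤ, (∀ k, G (k + 2) = G (k + 1) + G k) →
      ∀ a, G (a + 4 * e) + G a = L * G (a + 2 * e)) ∧
    (∃ L : ℤ, ∀ G : ℕ → ℤ, (∀ k, G (k + 2) = G (k + 1) + G k) →
      ∀ a, G (a + 4 * (e + 1)) + G a = L * G (a + 2 * (e + 1))) := by
  have h4 : ∀ G : ℕ → ℤ, (∀ k, G (k + 2) = G (k + 1) + G k) →
      ∀ a, G (a + 4) + G a = 3 * G (a + 2) := by
    intro G hG a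
    have h0 := hG a
    have h1 := hG (a + 1)
    have h2 := hG (a + 2)
    simp only [add_assoc] at h0 h1 h2
    norm_num at h0 h1 h2
    linarith
  induction e with
  | zero =>
    refine ⟨⟨2, fun G hG a => ?_⟩, ⟨3, fun G hG a => ?_⟩⟩
    · simp; ring
    · simpa using h4 G hG a
  | succ e ih =>
    obtain ⟨⟨L0, h0⟩, ⟨L1, h1⟩⟩ := ih
    refine ⟨⟨L1, h1⟩, ⟨3 * L1 - L0, fun G hG a => ?_⟩⟩
    have e0 := h0 G hG (a + 4)
    have e1 := h1 G hG (a + 2)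
    have e2 := h4 G hG a
    have e3 := h4 G hG (a + 4 + 4 * e)
    rw [show a + 4 * (e + 1 + 1) = a + 4 + 4 * e + 4 by ring,
      show a + 2 * (e + 1 + 1) = a + 4 + 2 * e by ring]
    rw [show a + 2 + 4 * (e + 1) = a + 4 + 4 * e + 2 by ring,
      show a + 2 + 2 * (e + 1) = a + 4 + 2 * e by ring] at e1
    linarith

theorem gf_sum (d n : ℕ) :
    ∃ C : ℤ, ∀ G : ℕ → ℤ, (∀ k, G (k + 2) = G (k + 1) + G k) →
      ∀ a, ∑ k ∈ Finset.range (2 * n + 1), G (a + 2 * d * k) = C * G (a + 2 * d * n) := by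
  induction n with
  | zero => exact ⟨1, fun G hG a => by simp⟩
  | succ n ih =>
    obtain ⟨C, hC⟩ := ih
    obtain ⟨L, hL⟩ := (gf_pair (d * (n + 1))).1
    refine ⟨C + L, fun G hG a => ?_⟩
    have h1 := hC G hG (a + 2 * d)
    have h2 := hL G hG a
    rw [show 2 * (n + 1) + 1 = (2 * n + 1) + 1 + 1 by ring, Finset.sum_range_succ,
      Finset.sum_range_succ']
    have h3 : ∀ k, a + 2 * d * (k + 1) = a + 2 * d + 2 * d * k := fun k => by ring
    rw [show a + 4 * (d * (n + 1)) = a + 2 * d * (2 * n + 1 + 1) by ring,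
      show a + 2 * (d * (n + 1)) = a + 2 * d * (n + 1) by ring] at h2
    rw [← h3 n] at h1
    simp only [← h3] at h1
    rw [h1, mul_zero, add_zero]
    linarith


/-- For any two generalized Fibonacci sequences `G` and `H` (integer
sequences satisfying the Fibonacci recurrence) and any `n ≥ 1`, the cross products
of main-diagonal and sub-diagonal sums of the `(2n+1) × (2n+1)` grid agree, i.e.
the diagonal-sum ratio depends only on `n`. -/
theorem genFib_grid_diag_ratio_independent
    (n : ℕ) (hn : 1 ≤ n) (G H : ℕ → ℤ)
    (hG : ∀ k, G (k + 2) = G (k + 1) + G k)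
    (hH : ∀ k, H (k + 2) = H (k + 1) + H k) :
    (∑ k ∈ Finset.range (2 * n + 1), G (2 * k * (n + 1))) *
      (∑ k ∈ Finset.range (2 * n + 1), H (2 * n * (k + 1))) =
    (∑ k ∈ Finset.range (2 * n + 1), H (2 * k * (n + 1))) *
      (∑ k ∈ Finset.range (2 * n + 1), G (2 * n * (k + 1))) := by
  obtain ⟨C, hC⟩ := gf_sum (n + 1) n
  obtain ⟨D, hD⟩ := gf_sum n n
  have key1 : ∀ F : ℕ → ℤ, (∀ k, F (k + 2) = F (k + 1) + F k) →
      ∑ k ∈ Finset.range (2 * n + 1), F (2 * k * (n + 1)) = C * F (2 * n * (n + 1)) := by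
    intro F hF
    have h := hC F hF 0
    rw [show 0 + 2 * (n + 1) * n = 2 * n * (n + 1) by ring] at h
    rw [← h]
    exact Finset.sum_congr rfl fun k _ => by congr 1; ring
  have key2 : ∀ F : ℕ → ℤ, (∀ k, F (k + 2) = F (k + 1) + F k) →
      ∑ k ∈ Finset.range (2 * n + 1), F (2 * n * (k + 1)) = D * F (2 * n * (n + 1)) := by
    intro F hF
    have h := hD F hF (2 * n)
    rw [show 2 * n + 2 * n * n = 2 * n * (n + 1) by ring] at h
    rw [← h]
    exact Finset.sum_congr rfl fun k _ => by congr 1; ring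
  rw [key1 G hG, key1 H hH, key2 G hG, key2 H hH]
  ring
end

section
/- Let n ≥ 1 be a natural number and let G be any generalized Fibonacci sequence. Then (∑_{k=0}^{2n} G_{2k(n+1)}) · (∑_{k=0}^{2n} F_{2n(k+1)}) = (∑_{k=0}^{2n} F_{2k(n+1)}) · (∑_{k=0}^{2n} G_{2n(k+1)}), where F denotes the Fibonacci numbers. Hence the diagonal-sum ratio of any generalized Fibonacci sequence in a (2n+1)×(2n+1) grid equals that of the Fibonacci sequence itself. -/
/-- For even shift `2 e`, `G_{c+2e} + G_{c-2e} = L * G_c` with `L` independent of `G`. -/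
lemma genFib_even_lucas (e : ℕ) : ∃ L : ℤ, ∀ G : ℕ → ℤ,
    (∀ k, G (k + 2) = G (k + 1) + G k) → ∀ a, G (a + 4 * e) + G a = L * G (a + 2 * e) := by
  induction e using Nat.strong_induction_on with
  | _ e ih =>
    match e, ih with
    | 0, _ => exact ⟨2, fun G _ a => by simp; ring⟩
    | 1, _ =>
      refine ⟨3, fun G hG a => ?_⟩
      have h0 := hG a
      have h1 := hG (a + 1)
      have h2 := hG (a + 2)
      simp only [add_assoc, Nat.reduceAdd] at *
      norm_num
      linarith
    | e + 2, ih =>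
      obtain ⟨L0, h0⟩ := ih e (by omega)
      obtain ⟨L1, h1⟩ := ih (e + 1) (by omega)
      have step : ∀ G : ℕ → ℤ, (∀ k, G (k + 2) = G (k + 1) + G k) →
          ∀ a, G (a + 4) = 3 * G (a + 2) - G a := by
        intro G hG a
        have h0 := hG a
        have h1 := hG (a + 1)
        have h2 := hG (a + 2)
        simp only [add_assoc, Nat.reduceAdd] at *
        linarith
      refine ⟨3 * L1 - L0, fun G hG a => ?_⟩
      have e0 := h0 G hG (a + 4)
      have e1 := h1 G hG (a + 2)
      have s0 := step G hG a
      have s1 := step G hG (a + 4 * e + 4)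
      rw [show a + 4 + 4 * e = a + 4 * e + 4 by ring,
        show a + 4 + 2 * e = a + 2 * e + 4 by ring] at e0
      rw [show a + 2 + 4 * (e + 1) = a + 4 * e + 4 + 2 by ring,
        show a + 2 + 2 * (e + 1) = a + 2 * e + 4 by ring] at e1
      rw [show a + 4 * (e + 2) = a + 4 * e + 4 + 4 by ring,
        show a + 2 * (e + 2) = a + 2 * e + 4 by ring]
      linarith

/-- A symmetric sum with even step is a `G`-independent multiple of the central term. -/
lemma genFib_sum_center (e n : ℕ) : ∃ c : ℤ, ∀ G : ℕ → ℤ,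
    (∀ k, G (k + 2) = G (k + 1) + G k) → ∀ a,
    ∑ k ∈ Finset.range (2 * n + 1), G (a + k * (2 * e)) = c * G (a + n * (2 * e)) := by
  induction n with
  | zero => exact ⟨1, fun G _ a => by simp⟩
  | succ n ih =>
    obtain ⟨c, hc⟩ := ih
    obtain ⟨L, hL⟩ := genFib_even_lucas ((n + 1) * e)
    refine ⟨c + L, fun G hG a => ?_⟩
    have h1 := hc G hG (a + 2 * e)
    have h2 := hL G hG a
    rw [show 2 * (n + 1) + 1 = (2 * n + 1) + 1 + 1 by ring, Finset.sum_range_succ,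
      Finset.sum_range_succ']
    have h3 : ∀ k, a + (k + 1) * (2 * e) = a + 2 * e + k * (2 * e) := fun k => by ring
    simp only [h3]
    rw [h1, show a + 2 * e + (2 * n + 1) * (2 * e) = a + 4 * ((n + 1) * e) by ring,
      show a + 2 * e + n * (2 * e) = a + 2 * ((n + 1) * e) by ring, zero_mul, add_zero]
    linarith

/-- The diagonal-sum ratio of any generalized Fibonacci sequence in a
`(2n+1) × (2n+1)` grid equals that of the Fibonacci sequence itself. -/
theorem genFib_grid_diag_ratio_eq_fib
    (n : ℕ) (hn : 1 ≤ n) (G : ℕ → ℤ)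
    (hG : ∀ k, G (k + 2) = G (k + 1) + G k) :
    (∑ k ∈ Finset.range (2 * n + 1), G (2 * k * (n + 1))) *
      (∑ k ∈ Finset.range (2 * n + 1), (Nat.fib (2 * n * (k + 1)) : ℤ)) =
    (∑ k ∈ Finset.range (2 * n + 1), (Nat.fib (2 * k * (n + 1)) : ℤ)) *
      (∑ k ∈ Finset.range (2 * n + 1), G (2 * n * (k + 1))) := by
  obtain ⟨c, hc⟩ := genFib_sum_center (n + 1) n
  obtain ⟨d, hd⟩ := genFib_sum_center n n
  have hF : ∀ k, (Nat.fib (k + 2) : ℤ) = Nat.fib (k + 1) + Nat.fib k := by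
    intro k
    rw [Nat.fib_add_two]
    push_cast
    ring
  have i1 : ∀ k, 2 * k * (n + 1) = 0 + k * (2 * (n + 1)) := fun k => by ring
  have i2 : ∀ k, 2 * n * (k + 1) = 2 * n + k * (2 * n) := fun k => by ring
  have c1 := hc G hG 0
  have c2 := hc (fun k => (Nat.fib k : ℤ)) hF 0
  have d1 := hd G hG (2 * n)
  have d2 := hd (fun k => (Nat.fib k : ℤ)) hF (2 * n)
  simp only [i1, i2]
  rw [c1, c2, d1, d2, show 2 * n + n * (2 * n) = 0 + n * (2 * (n + 1)) by ring]
  ring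
end

section
/- For every natural number n ≥ 1, (∑_{k=0}^{2n} F_{2k(n+1)}) · (∑_{k=0}^{2n} L_{2n(k+1)}) = (∑_{k=0}^{2n} L_{2k(n+1)}) · (∑_{k=0}^{2n} F_{2n(k+1)}), i.e., the ratio of the main-diagonal sum to the sub-diagonal sum in a (2n+1)×(2n+1) grid is the same for the Fibonacci sequence and the Lucas sequence. -/
/-- The Lucas numbers: `L 0 = 2`, `L 1 = 1`, `L (k+2) = L (k+1) + L k`. -/
def lucas : ℕ → ℕ
  | 0 => 2
  | 1 => 1
  | (k + 2) => lucas (k + 1) + lucas k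

open Real in
lemma lucas_coe : ∀ m : ℕ, (lucas m : ℝ) = goldenRatio ^ m + goldenConj ^ m
  | 0 => by norm_num [lucas]
  | 1 => by simp [lucas]
  | (k + 2) => by
    have h1 := lucas_coe (k + 1)
    have h2 := lucas_coe k
    have e1 := goldenRatio_sq
    have e2 := goldenConj_sq
    rw [lucas]
    push_cast
    rw [h1, h2, pow_add _ k 2, pow_add _ k 2, e1, e2]
    ring

open Real in
/-- Reflecting a progression of even exponents `f` about its centre. -/
lemma sum_reflect_golden (N M : ℕ) (f : ℕ → ℕ) (he : ∀ k, Even (f k))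
    (hf : ∀ k < N, f k + f (N - 1 - k) = M) :
    ∑ k ∈ Finset.range N, goldenRatio ^ f k =
      goldenRatio ^ M * ∑ k ∈ Finset.range N, goldenConj ^ f k := by
  rw [← Finset.sum_range_reflect, Finset.mul_sum]
  refine Finset.sum_congr rfl fun k hk => ?_
  rw [← hf k (Finset.mem_range.1 hk), pow_add, mul_right_comm, ← mul_pow,
    goldenRatio_mul_goldenConj, (he k).neg_one_pow, one_mul]

/-- The diagonal-sum ratio in a `(2n+1) × (2n+1)` grid is the same for
the Fibonacci and the Lucas sequences. -/
theorem fib_lucas_grid_diag_ratio_eq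
    (n : ℕ) (hn : 1 ≤ n) :
    (∑ k ∈ Finset.range (2 * n + 1), Nat.fib (2 * k * (n + 1))) *
      (∑ k ∈ Finset.range (2 * n + 1), lucas (2 * n * (k + 1))) =
    (∑ k ∈ Finset.range (2 * n + 1), lucas (2 * k * (n + 1))) *
      (∑ k ∈ Finset.range (2 * n + 1), Nat.fib (2 * n * (k + 1))) := by
  have hA := sum_reflect_golden (2 * n + 1) (4 * n * (n + 1)) (fun k => 2 * k * (n + 1))
    (fun k => by simp [mul_assoc]) (fun k hk => by
      obtain ⟨j, hj⟩ : ∃ j, 2 * n = k + j := ⟨2 * n - k, by omega⟩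
      have : 2 * n + 1 - 1 - k = j := by omega
      simp only [this]
      calc 2 * k * (n + 1) + 2 * j * (n + 1) = 2 * (k + j) * (n + 1) := by ring
        _ = _ := by rw [← hj]; ring)
  have hB := sum_reflect_golden (2 * n + 1) (4 * n * (n + 1)) (fun k => 2 * n * (k + 1))
    (fun k => by simp [mul_assoc]) (fun k hk => by
      obtain ⟨j, hj⟩ : ∃ j, 2 * n = k + j := ⟨2 * n - k, by omega⟩
      have : 2 * n + 1 - 1 - k = j := by omega
      simp only [this]
      calc 2 * n * (k + 1) + 2 * n * (j + 1) = 2 * n * ((k + j) + 2) := by ring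
        _ = _ := by rw [← hj]; ring)
  have : ((∑ k ∈ Finset.range (2 * n + 1), (Nat.fib (2 * k * (n + 1)) : ℝ)) *
      (∑ k ∈ Finset.range (2 * n + 1), (lucas (2 * n * (k + 1)) : ℝ))) =
    (∑ k ∈ Finset.range (2 * n + 1), (lucas (2 * k * (n + 1)) : ℝ)) *
      (∑ k ∈ Finset.range (2 * n + 1), (Nat.fib (2 * n * (k + 1)) : ℝ)) := by
    simp only [lucas_coe, Real.coe_fib_eq, ← Finset.sum_div, Finset.sum_sub_distrib,
      Finset.sum_add_distrib]
    rw [hA, hB]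
    ring
  exact_mod_cast this
end

section
/- Let G : ℕ → ℤ be a generalized Fibonacci sequence, let m ≥ 1 and i with 0 ≤ i ≤ m − 1 be natural numbers, and let n₁ ≤ n₂ be natural numbers. Set a = (1 + √5)/2 and b = (1 − √5)/2. Then, as an identity of real numbers, ∑_{k=n₁}^{n₂} G_{mk+i} = (1/(a^m − b^m)) · [ (G_{m+i} − b^m · G_i) · (a^{m n₁} − a^{m(n₂+1)})/(1 − a^m) − (G_{m+i} − a^m · G_i) · (b^{m n₁} − b^{m(n₂+1)})/(1 − b^m) ]. -/
theorem genFib_binet (G : ℕ → ℤ) (hG : ∀ k, G (k + 2) = G (k + 1) + G k) (a b : ℝ)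
    (ha : a ^ 2 = a + 1) (hb : b ^ 2 = b + 1) (hab : a - b ≠ 0) :
    ∃ c d : ℝ, ∀ k, (G k : ℝ) = c * a ^ k + d * b ^ k := by
  refine ⟨(G 1 - b * G 0) / (a - b), (a * G 0 - G 1) / (a - b), fun k => ?_⟩
  induction k using Nat.twoStepInduction with
  | zero => field_simp; ring
  | one => field_simp; ring
  | more n h0 h1 =>
    rw [hG n, Int.cast_add, h0, h1, pow_add a n 2, pow_add b n 2, ha, hb]
    ring

theorem geom_Icc_aux (x : ℝ) (hx : 1 - x ≠ 0) (n₁ n₂ : ℕ) (h : n₁ ≤ n₂) :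
    ∑ k ∈ Finset.Icc n₁ n₂, x ^ k = (x ^ n₁ - x ^ (n₂ + 1)) / (1 - x) := by
  induction n₂, h using Nat.le_induction with
  | base => simp; field_simp; ring
  | succ n hn ih =>
    rw [Finset.sum_Icc_succ_top (by omega), ih]
    field_simp
    ring

theorem genFib_sum_aux (G : ℕ → ℤ) (hG : ∀ k, G (k + 2) = G (k + 1) + G k) (a b : ℝ)
    (ha : a ^ 2 = a + 1) (hb : b ^ 2 = b + 1) (hab : a - b ≠ 0)
    (m i n₁ n₂ : ℕ) (h : n₁ ≤ n₂) (h1 : 1 - a ^ m ≠ 0) (h2 : 1 - b ^ m ≠ 0)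
    (h3 : a ^ m - b ^ m ≠ 0) :
    (∑ k ∈ Finset.Icc n₁ n₂, (G (m * k + i) : ℝ)) =
      (1 / (a ^ m - b ^ m)) *
        (((G (m + i) : ℝ) - b ^ m * (G i : ℝ)) *
            ((a ^ (m * n₁) - a ^ (m * (n₂ + 1))) / (1 - a ^ m)) -
          ((G (m + i) : ℝ) - a ^ m * (G i : ℝ)) *
            ((b ^ (m * n₁) - b ^ (m * (n₂ + 1))) / (1 - b ^ m))) := by
  obtain ⟨c, d, hcd⟩ := genFib_binet G hG a b ha hb hab
  have e : (∑ k ∈ Finset.Icc n₁ n₂, (G (m * k + i) : ℝ)) =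
      c * a ^ i * ∑ k ∈ Finset.Icc n₁ n₂, (a ^ m) ^ k +
      d * b ^ i * ∑ k ∈ Finset.Icc n₁ n₂, (b ^ m) ^ k := by
    rw [Finset.mul_sum, Finset.mul_sum, ← Finset.sum_add_distrib]
    refine Finset.sum_congr rfl fun k _ => ?_
    rw [hcd, pow_add, pow_add, pow_mul, pow_mul]
    ring
  rw [e, geom_Icc_aux _ h1 _ _ h, geom_Icc_aux _ h2 _ _ h, hcd, hcd,
    pow_mul a, pow_mul b, pow_mul a, pow_mul b, pow_add a m i, pow_add b m i]
  generalize ((a ^ m) ^ n₁ - (a ^ m) ^ (n₂ + 1)) / (1 - a ^ m) = S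
  generalize ((b ^ m) ^ n₁ - (b ^ m) ^ (n₂ + 1)) / (1 - b ^ m) = T
  field_simp
  ring

/-- closed formula (over ℝ) for the sum of a block of an equidistant
subsequence of a generalized Fibonacci sequence, where `a = (1+√5)/2` and
`b = (1-√5)/2`. -/
theorem genFib_equidistant_sum (G : ℕ → ℤ)
    (hG : ∀ k, G (k + 2) = G (k + 1) + G k)
    (m i : ℕ) (hm : 1 ≤ m) (hi : i ≤ m - 1)
    (n₁ n₂ : ℕ) (h : n₁ ≤ n₂) :
    (∑ k ∈ Finset.Icc n₁ n₂, (G (m * k + i) : ℝ)) =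
      (1 / (((1 + Real.sqrt 5) / 2) ^ m - ((1 - Real.sqrt 5) / 2) ^ m)) *
        (((G (m + i) : ℝ) - ((1 - Real.sqrt 5) / 2) ^ m * (G i : ℝ)) *
            ((((1 + Real.sqrt 5) / 2) ^ (m * n₁) - ((1 + Real.sqrt 5) / 2) ^ (m * (n₂ + 1))) /
              (1 - ((1 + Real.sqrt 5) / 2) ^ m)) -
          ((G (m + i) : ℝ) - ((1 + Real.sqrt 5) / 2) ^ m * (G i : ℝ)) *
            ((((1 - Real.sqrt 5) / 2) ^ (m * n₁) - ((1 - Real.sqrt 5) / 2) ^ (m * (n₂ + 1))) /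
              (1 - ((1 - Real.sqrt 5) / 2) ^ m))) := by
  have hm0 : m ≠ 0 := by omega
  have ha1 : 1 < (1 + Real.sqrt 5) / 2 := Real.one_lt_goldenRatio
  have hb0 : (1 - Real.sqrt 5) / 2 < 0 := Real.goldenConj_neg
  have hb1 : -1 < (1 - Real.sqrt 5) / 2 := Real.neg_one_lt_goldenConj
  have hA : 1 < ((1 + Real.sqrt 5) / 2) ^ m := one_lt_pow₀ ha1 hm0
  have hB : ((1 - Real.sqrt 5) / 2) ^ m < 1 := by
    have h4 : |(1 - Real.sqrt 5) / 2| < 1 := abs_lt.2 ⟨hb1, by linarith⟩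
    calc ((1 - Real.sqrt 5) / 2) ^ m ≤ |((1 - Real.sqrt 5) / 2) ^ m| := le_abs_self _
      _ = |(1 - Real.sqrt 5) / 2| ^ m := abs_pow _ _
      _ < 1 := pow_lt_one₀ (abs_nonneg _) h4 hm0
  exact genFib_sum_aux G hG ((1 + Real.sqrt 5) / 2) ((1 - Real.sqrt 5) / 2) Real.goldenRatio_sq Real.goldenConj_sq (ne_of_gt (by linarith))
    m i n₁ n₂ h (ne_of_lt (by linarith)) (ne_of_gt (by linarith)) (ne_of_gt (by linarith))
end

section
/- For every natural number n ≥ 1, the following identity of integers holds: (−F_{2n+2} − F_{4n²+4n} + F_{4n²+6n+2}) · (−2 + L_{2n} + L_{4n²+2n} − L_{4n²+4n}) = (−F_{2n} − F_{4n²+2n} + F_{4n²+4n}) · (2 − L_{2n+2} + L_{4n²+4n} − L_{4n²+6n+2}), where F denotes the Fibonacci numbers and L the Lucas numbers, with the displayed expressions interpreted in ℤ. -/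
theorem lucas_binet (k : ℕ) :
    (lucas k : ℝ) = Real.goldenRatio ^ k + Real.goldenConj ^ k := by
  induction k using Nat.twoStepInduction with
  | zero => norm_num [lucas]
  | one => simp [lucas]
  | more k h1 h2 =>
    rw [lucas]
    push_cast
    rw [h1, h2, pow_add _ k 2, pow_add _ k 2, Real.goldenRatio_sq, Real.goldenConj_sq]
    ring

theorem conj_pow_even (k : ℕ) :
    Real.goldenConj ^ (2 * k) = (Real.goldenRatio ^ (2 * k))⁻¹ := by
  rw [← inv_pow, Real.inv_goldenRatio, Even.neg_pow (even_two_mul k)]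

theorem key_general (a p b : ℕ) :
    (-(Nat.fib (2 * b) : ℤ) - (Nat.fib (2 * a + 2 * p) : ℤ)
        + (Nat.fib (2 * a + 2 * p + 2 * b) : ℤ)) *
      (-2 + (lucas (2 * a) : ℤ) + (lucas (2 * p) : ℤ) - (lucas (2 * a + 2 * p) : ℤ)) =
    (-(Nat.fib (2 * a) : ℤ) - (Nat.fib (2 * p) : ℤ)
        + (Nat.fib (2 * a + 2 * p) : ℤ)) *
      (2 - (lucas (2 * b) : ℤ) + (lucas (2 * a + 2 * p) : ℤ)
        - (lucas (2 * a + 2 * p + 2 * b) : ℤ)) := by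
  have h : Real.goldenRatio ≠ 0 := Real.goldenRatio_ne_zero
  have hX := pow_ne_zero (2 * a) h
  have hY := pow_ne_zero (2 * p) h
  have hZ := pow_ne_zero (2 * b) h
  have h5 : (√5 : ℝ) ≠ 0 := by positivity
  rify
  simp only [Real.coe_fib_eq, lucas_binet, pow_add, conj_pow_even]
  generalize Real.goldenRatio ^ (2 * a) = X at *
  generalize Real.goldenRatio ^ (2 * p) = Y at *
  generalize Real.goldenRatio ^ (2 * b) = Z at *
  field_simp
  ring

/-- the key integer identity from the proof of the main theorem. -/
theorem fib_lucas_key_identity (n : ℕ) (hn : 1 ≤ n) :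
    (-(Nat.fib (2 * n + 2) : ℤ) - (Nat.fib (4 * n ^ 2 + 4 * n) : ℤ)
        + (Nat.fib (4 * n ^ 2 + 6 * n + 2) : ℤ)) *
      (-2 + (lucas (2 * n) : ℤ) + (lucas (4 * n ^ 2 + 2 * n) : ℤ)
        - (lucas (4 * n ^ 2 + 4 * n) : ℤ)) =
    (-(Nat.fib (2 * n) : ℤ) - (Nat.fib (4 * n ^ 2 + 2 * n) : ℤ)
        + (Nat.fib (4 * n ^ 2 + 4 * n) : ℤ)) *
      (2 - (lucas (2 * n + 2) : ℤ) + (lucas (4 * n ^ 2 + 4 * n) : ℤ)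
        - (lucas (4 * n ^ 2 + 6 * n + 2) : ℤ)) := by
  have := key_general n (2 * n ^ 2 + n) (n + 1)
  rw [show 2 * n + 2 * (2 * n ^ 2 + n) + 2 * (n + 1) = 4 * n ^ 2 + 6 * n + 2 by ring,
    show 2 * n + 2 * (2 * n ^ 2 + n) = 4 * n ^ 2 + 4 * n by ring,
    show 2 * (2 * n ^ 2 + n) = 4 * n ^ 2 + 2 * n by ring,
    show 2 * (n + 1) = 2 * n + 2 by ring] at this
  exact this
end
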